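/- arXiv:2404.12710 — 2 statements merged into one kernel-verified Lean document; each statement's English description precedes it below -/
import Mathlib

section
/- Under the hypotheses of the deterministic Theorem 1 recursion (E a finite-dimensional real inner product space; f : E → ℝ differentiable, c-strongly convex with c > 0, gradient L-Lipschitz with c ≤ L, attaining minimum f* at w*; μ > 0, M ≥ 0, M_G ≥ μ²; sequences with a_s > 0, 0 < η_s ≤ μ/(L·M_G·a_s), ⟪∇f(w_s), g_s⟫ ≥ μ‖∇f(w_s)‖², ‖g_s‖² ≤ M + M_G‖∇f(w_s)‖², w_{s+1} = w_s − η_s·a_s·g_s), if in addition the series ∑_{s≥1} η_s·a_s diverges, then limsup_{s→∞} (f(w_s) − f*) ≤ L·M / (2·c²·μ²). -/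
open RealInnerProductSpace Filter

/-- Descent lemma: a function with `L`-Lipschitz gradient lies below its quadratic model. -/
theorem le_add_inner_gradient_add_sq_of_lipschitz
    {E : Type*} [NormedAddCommGroup E] [InnerProductSpace ℝ E] [CompleteSpace E]
    {f : E → ℝ} {L : ℝ} (hf : Differentiable ℝ f)
    (hlip : ∀ x y : E, ‖gradient f x - gradient f y‖ ≤ L * ‖x - y‖) (x d : E) :
    f (x + d) ≤ f x + ⟪gradient f x, d⟫ + L / 2 * ‖d‖ ^ 2 := by
  have hderiv : ∀ t : ℝ, HasDerivAt
      (fun t : ℝ => f (x + t • d) - t * ⟪gradient f x, d⟫ - t ^ 2 * (L / 2 * ‖d‖ ^ 2))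
      (⟪gradient f (x + t • d), d⟫ - ⟪gradient f x, d⟫ - 2 * t * (L / 2 * ‖d‖ ^ 2)) t := by
    intro t
    have hline : HasDerivAt (fun t : ℝ => x + t • d) d t := by
      simpa using ((hasDerivAt_id t).smul_const d).const_add x
    have hcomp := (hf (x + t • d)).hasGradientAt.hasFDerivAt.comp_hasDerivAt t hline
    rw [InnerProductSpace.toDual_apply_apply] at hcomp
    have hlin := (hasDerivAt_id t).mul_const ⟪gradient f x, d⟫
    have hsq := ((hasDerivAt_id t).pow 2).mul_const (L / 2 * ‖d‖ ^ 2)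
    exact ((hcomp.sub hlin).sub hsq).congr_deriv (by simp)
  have hanti := antitoneOn_of_deriv_nonpos (convex_Icc (0 : ℝ) 1)
    (fun t _ => (hderiv t).continuousAt.continuousWithinAt)
    (fun t _ => (hderiv t).differentiableAt.differentiableWithinAt)
    (fun t ht => by
      rw [interior_Icc] at ht
      rw [(hderiv t).deriv, ← inner_sub_left]
      have hcs := real_inner_le_norm (gradient f (x + t • d) - gradient f x) d
      have hl := hlip (x + t • d) x
      rw [add_sub_cancel_left, norm_smul, Real.norm_of_nonneg ht.1.le] at hl
      nlinarith [mul_le_mul_of_nonneg_right hl (norm_nonneg d)])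
  have h := hanti (Set.left_mem_Icc.2 zero_le_one) (Set.right_mem_Icc.2 zero_le_one) zero_le_one
  simp only [one_smul, zero_smul, add_zero] at h
  linarith

/-- First-order lower bound for strongly convex functions. -/
theorem add_inner_gradient_add_sq_le_of_strongConvex
    {E : Type*} [NormedAddCommGroup E] [InnerProductSpace ℝ E] [CompleteSpace E]
    {f : E → ℝ} {c : ℝ} (hf : Differentiable ℝ f)
    (hconv : ConvexOn ℝ Set.univ fun x => f x - (c / 2) * ‖x‖ ^ 2) (x d : E) :
    f x + ⟪gradient f x, d⟫ + c / 2 * ‖d‖ ^ 2 ≤ f (x + d) := by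
  have hderiv : HasDerivAt (fun t : ℝ => f (x + t • d) - c / 2 * ‖x + t • d‖ ^ 2)
      (⟪gradient f x, d⟫ - c / 2 * (2 * ⟪x, d⟫)) 0 := by
    have hline : HasDerivAt (fun t : ℝ => x + t • d) d 0 := by
      simpa using ((hasDerivAt_id (0 : ℝ)).smul_const d).const_add x
    have hcomp := (hf (x + (0 : ℝ) • d)).hasGradientAt.hasFDerivAt.comp_hasDerivAt 0 hline
    rw [InnerProductSpace.toDual_apply_apply] at hcomp
    exact (hcomp.sub (hline.norm_sq.const_mul (c / 2))).congr_deriv (by simp)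
  have hline_conv : ConvexOn ℝ Set.univ
      (fun t : ℝ => f (x + t • d) - c / 2 * ‖x + t • d‖ ^ 2) := by
    refine ⟨convex_univ, fun p _ q _ α β hα hβ hαβ => ?_⟩
    have h := hconv.2 (Set.mem_univ (x + p • d)) (Set.mem_univ (x + q • d)) hα hβ hαβ
    have hcomb : α • (x + p • d) + β • (x + q • d) = x + (α • p + β • q) • d := by
      calc α • (x + p • d) + β • (x + q • d)
          = (α + β) • x + (α • p + β • q) • d := by
            simp only [smul_eq_mul]; module
        _ = _ := by rw [hαβ, one_smul]
    rwa [hcomb] at h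
  have h := hline_conv.le_slope_of_hasDerivAt (Set.mem_univ 0) (Set.mem_univ 1) zero_lt_one hderiv
  simp only [slope_def_field, one_smul, zero_smul, add_zero, sub_zero, div_one] at h
  have hnorm := norm_add_sq_real x d
  rw [hnorm] at h
  linarith

/-- Polyak–Łojasiewicz inequality for strongly convex functions. -/
theorem two_mul_sub_le_norm_gradient_sq_of_strongConvex
    {E : Type*} [NormedAddCommGroup E] [InnerProductSpace ℝ E] [CompleteSpace E]
    {f : E → ℝ} {c : ℝ} (hc : 0 < c) (hf : Differentiable ℝ f)
    (hconv : ConvexOn ℝ Set.univ fun x => f x - (c / 2) * ‖x‖ ^ 2) (x y : E) :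
    2 * c * (f x - f y) ≤ ‖gradient f x‖ ^ 2 := by
  have h := add_inner_gradient_add_sq_le_of_strongConvex hf hconv x (y - x)
  rw [add_sub_cancel] at h
  have hsq := norm_add_sq_real (gradient f x) (c • (y - x))
  rw [inner_smul_right, norm_smul, Real.norm_of_nonneg hc.le] at hsq
  nlinarith [sq_nonneg ‖gradient f x + c • (y - x)‖, mul_le_mul_of_nonneg_left h hc.le]

/-- One step along a noisy descent direction `v` with small step size `t` contracts the
optimality gap towards `L * M / (2 * c ^ 2 * μ ^ 2)`. -/
theorem gap_sub_le_of_biased_gradient_step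
    {E : Type*} [NormedAddCommGroup E] [InnerProductSpace ℝ E] [CompleteSpace E]
    {f : E → ℝ} {c L μ M M_G t : ℝ} (hc : 0 < c) (hL : 0 < L) (hf : Differentiable ℝ f)
    (hconv : ConvexOn ℝ Set.univ fun x => f x - (c / 2) * ‖x‖ ^ 2)
    (hlip : ∀ x y : E, ‖gradient f x - gradient f y‖ ≤ L * ‖x - y‖)
    (hμ : 0 < μ) (hM : 0 ≤ M) (ht : 0 < t) (htL : L * M_G * t ≤ μ) (htc : t * (c * μ) ≤ 1)
    {x v : E} (hinner : μ * ‖gradient f x‖ ^ 2 ≤ ⟪gradient f x, v⟫)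
    (hv : ‖v‖ ^ 2 ≤ M + M_G * ‖gradient f x‖ ^ 2) (y : E) :
    f (x - t • v) - f y - L * M / (2 * c ^ 2 * μ ^ 2) ≤
      (1 - c * μ * t) * (f x - f y - L * M / (2 * c ^ 2 * μ ^ 2)) := by
  have hdesc := le_add_inner_gradient_add_sq_of_lipschitz hf hlip x (-(t • v))
  rw [← sub_eq_add_neg, inner_neg_right, inner_smul_right, norm_neg, norm_smul,
    Real.norm_of_nonneg ht.le, mul_pow] at hdesc
  have hpl := two_mul_sub_le_norm_gradient_sq_of_strongConvex hc hf hconv x y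
  set G := ‖gradient f x‖ ^ 2 with hG
  have hG0 : 0 ≤ G := sq_nonneg _
  have hlin : t * (μ * G) ≤ t * ⟪gradient f x, v⟫ := mul_le_mul_of_nonneg_left hinner ht.le
  have hquad : L / 2 * (t ^ 2 * ‖v‖ ^ 2) ≤ L / 2 * (t ^ 2 * (M + M_G * G)) := by gcongr
  have hstep : (L * M_G * t) * (t * G) ≤ μ * (t * G) :=
    mul_le_mul_of_nonneg_right htL (by positivity)
  have hgap : (t * μ / 2) * (2 * c * (f x - f y)) ≤ (t * μ / 2) * G :=
    mul_le_mul_of_nonneg_left hpl (by positivity)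
  have hnoise : L * M * t ^ 2 / 2 ≤ c * μ * t * (L * M / (2 * c ^ 2 * μ ^ 2)) := by
    have heq : c * μ * t * (L * M / (2 * c ^ 2 * μ ^ 2)) = L * M * t / 2 * (1 / (c * μ)) := by
      field_simp
    have hle : t ≤ 1 / (c * μ) := (le_div_iff₀ (by positivity)).2 htc
    rw [heq]
    calc L * M * t ^ 2 / 2 = L * M * t / 2 * t := by ring
      _ ≤ _ := mul_le_mul_of_nonneg_left hle (by positivity)
  linarith

/-- Discrete Grönwall bound for a contraction recursion with variable rates. -/
theorem le_exp_neg_sum_mul_of_le_one_sub_mul {u r : ℕ → ℝ} (hr : ∀ s ≥ 1, r s ≤ 1)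
    (hu : ∀ s ≥ 1, u (s + 1) ≤ (1 - r s) * u s) (n : ℕ) :
    u (n + 1) ≤ Real.exp (-∑ i ∈ Finset.Icc 1 n, r i) * max (u 1) 0 := by
  induction n with
  | zero => simp
  | succ n ih =>
    have hs : n + 1 ≥ 1 := by omega
    have hexp : 1 - r (n + 1) ≤ Real.exp (-r (n + 1)) := by
      linarith [Real.add_one_le_exp (-r (n + 1))]
    rw [Finset.sum_Icc_succ_top hs, neg_add, Real.exp_add]
    calc u (n + 1 + 1) ≤ (1 - r (n + 1)) * u (n + 1) := hu _ hs
      _ ≤ (1 - r (n + 1)) * (Real.exp (-∑ i ∈ Finset.Icc 1 n, r i) * max (u 1) 0) :=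
        mul_le_mul_of_nonneg_left ih (by linarith [hr _ hs])
      _ ≤ Real.exp (-r (n + 1)) * (Real.exp (-∑ i ∈ Finset.Icc 1 n, r i) * max (u 1) 0) := by
        gcongr
      _ = _ := by ring

/-- Asymptotic form of FedMeS Theorem 1: if in addition `∑ η_s a_s` diverges, then
`limsup_{s→∞} (f(w_s) − f*) ≤ LM/(2c²μ²)`. -/
theorem fedmes_theorem1_limsup
    {E : Type*} [NormedAddCommGroup E] [InnerProductSpace ℝ E] [FiniteDimensional ℝ E]
    (c L : ℝ) (hc : 0 < c) (hL : 0 < L) (hcL : c ≤ L)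
    (f : E → ℝ) (hf : Differentiable ℝ f)
    (hconv : ConvexOn ℝ Set.univ fun x => f x - (c / 2) * ‖x‖ ^ 2)
    (hlip : ∀ x y : E, ‖gradient f x - gradient f y‖ ≤ L * ‖x - y‖)
    (wStar : E) (hmin : ∀ x : E, f wStar ≤ f x)
    (μ M M_G : ℝ) (hμ : 0 < μ) (hM : 0 ≤ M) (hMG : μ ^ 2 ≤ M_G)
    (w g : ℕ → E) (a η : ℕ → ℝ)
    (ha : ∀ s ≥ 1, 0 < a s)
    (hη : ∀ s ≥ 1, 0 < η s ∧ η s ≤ μ / (L * M_G * a s))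
    (hinner : ∀ s ≥ 1, ⟪gradient f (w s), g s⟫ ≥ μ * ‖gradient f (w s)‖ ^ 2)
    (hgbound : ∀ s ≥ 1, ‖g s‖ ^ 2 ≤ M + M_G * ‖gradient f (w s)‖ ^ 2)
    (hupd : ∀ s ≥ 1, w (s + 1) = w s - (η s * a s) • g s)
    (hdiv : Tendsto (fun n => ∑ i ∈ Finset.Icc 1 n, η i * a i) atTop atTop) :
    limsup (fun s => f (w s) - f wStar) atTop ≤ L * M / (2 * c ^ 2 * μ ^ 2) := by
  have := FiniteDimensional.complete ℝ E
  have hMG0 : 0 < M_G := (pow_pos hμ 2).trans_le hMG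
  set B := L * M / (2 * c ^ 2 * μ ^ 2) with hB
  have ht : ∀ s ≥ 1, 0 < η s * a s := fun s hs => mul_pos (hη s hs).1 (ha s hs)
  have htL : ∀ s ≥ 1, L * M_G * (η s * a s) ≤ μ := fun s hs => by
    have has := ha s hs
    have h := (le_div_iff₀ (by positivity)).1 (hη s hs).2
    linarith
  have htc : ∀ s ≥ 1, η s * a s * (c * μ) ≤ 1 := fun s hs => by
    have hpos := ht s hs
    have h : L * μ ^ 2 * (η s * a s) ≤ L * M_G * (η s * a s) := by gcongr
    have h' : c * μ ^ 2 * (η s * a s) ≤ L * μ ^ 2 * (η s * a s) := by gcongr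
    refine le_of_mul_le_mul_left ?_ hμ
    linarith [htL s hs]
  have hstep : ∀ s ≥ 1, f (w (s + 1)) - f wStar - B ≤
      (1 - c * μ * (η s * a s)) * (f (w s) - f wStar - B) := fun s hs => by
    rw [hupd s hs]
    exact gap_sub_le_of_biased_gradient_step hc hL hf hconv hlip hμ hM (ht s hs) (htL s hs)
      (htc s hs) (hinner s hs) (hgbound s hs) wStar
  have hbound := le_exp_neg_sum_mul_of_le_one_sub_mul
    (u := fun s => f (w s) - f wStar - B) (r := fun s => c * μ * (η s * a s))
    (fun s hs => by linarith [htc s hs]) hstep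
  simp only [← Finset.mul_sum] at hbound
  have hlim : Tendsto (fun n => B + Real.exp (-(c * μ * ∑ i ∈ Finset.Icc 1 n, η i * a i)) *
      max (f (w 1) - f wStar - B) 0) atTop (nhds B) := by
    have hexp := Real.tendsto_exp_neg_atTop_nhds_zero.comp
      (hdiv.const_mul_atTop (mul_pos hc hμ))
    simpa using (hexp.mul_const (max (f (w 1) - f wStar - B) 0)).const_add B
  rw [← limsup_nat_add _ 1, ← hlim.limsup_eq]
  refine limsup_le_limsup (Eventually.of_forall fun n => ?_) ?_ hlim.isBoundedUnder_le
  · linarith [hbound n]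
  · exact (isBoundedUnder_of ⟨0, fun n => sub_nonneg.2 (hmin _)⟩ :
      IsBoundedUnder (· ≥ ·) atTop _).isCoboundedUnder_le
end

section
/- Let E be a finite-dimensional real inner product space, c > 0, λ ≥ 0, and L : E → ℝ a differentiable function that is c-strongly convex, i.e. x ↦ L(x) − (c/2)‖x‖² is convex. For v ∈ E let W(v) ∈ E denote the unique minimizer of w ↦ L(w) + (λ/2)‖w − v‖². Let (Ω, ℙ) be a probability space, v̄ ∈ E, g ≥ 0 a real number, and V : Ω → E a random vector such that ω ↦ ‖V(ω) − v̄‖² is integrable with 𝔼‖V − v̄‖² ≤ g. Then ω ↦ ‖W(V(ω)) − W(v̄)‖² is integrable and 𝔼‖W(V) − W(v̄)‖² ≤ (λ/(c + λ))²·g. -/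
open MeasureTheory

open scoped RealInnerProductSpace Topology

/-- A strongly convex function grows at least quadratically away from a minimizer. -/
lemma StrongConvexOn.add_le_of_isMinOn {E : Type*} [NormedAddCommGroup E] [NormedSpace ℝ E]
    {s : Set E} {m : ℝ} {f : E → ℝ} (hf : StrongConvexOn s m f) {x y : E}
    (hx : x ∈ s) (hy : y ∈ s) (hmin : IsMinOn f s x) :
    f x + m / 2 * ‖x - y‖ ^ 2 ≤ f y := by
  have key : ∀ t ∈ Set.Ioo (0 : ℝ) 1, f x + (1 - t) * (m / 2 * ‖x - y‖ ^ 2) ≤ f y := by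
    rintro t ⟨ht0, ht1⟩
    have ht : 0 ≤ 1 - t := by linarith
    have hle := hf.2 hx hy ht ht0.le (by ring)
    have hmem := hf.1 hx hy ht ht0.le (by ring)
    have hge : f x ≤ f ((1 - t) • x + t • y) := hmin hmem
    simp only [smul_eq_mul] at hle
    refine le_of_mul_le_mul_left ?_ ht0
    linarith
  have hlim : Filter.Tendsto (fun t : ℝ => f x + (1 - t) * (m / 2 * ‖x - y‖ ^ 2)) (𝓝[>] 0)
      (𝓝 (f x + (1 - 0) * (m / 2 * ‖x - y‖ ^ 2))) :=
    (Continuous.tendsto (by fun_prop) 0).mono_left nhdsWithin_le_nhds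
  rw [sub_zero, one_mul] at hlim
  exact le_of_tendsto hlim
    (Filter.eventually_of_mem (Ioo_mem_nhdsGT one_pos) key)

/-- Adding `(l / 2) * ‖· - v‖ ^ 2` to a function raises its modulus of strong convexity by `l`. -/
lemma StrongConvexOn.add_sq_norm_sub {E : Type*} [NormedAddCommGroup E] [InnerProductSpace ℝ E]
    {s : Set E} {c : ℝ} {f : E → ℝ} (hf : StrongConvexOn s c f) (l : ℝ) (v : E) :
    StrongConvexOn s (c + l) fun w => f w + l / 2 * ‖w - v‖ ^ 2 := by
  rw [strongConvexOn_iff_convex] at hf ⊢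
  have hlin : ConvexOn ℝ s fun w => -l * ⟪v, w⟫ + l / 2 * ‖v‖ ^ 2 :=
    (((-l) • (innerSL ℝ v).toLinearMap).convexOn hf.1).add_const _
  refine (hf.add hlin).congr fun w _ => ?_
  simp only [Pi.add_apply]
  rw [norm_sub_sq_real, real_inner_comm]
  ring

/-- The proximal map of a strongly convex function is a contraction. -/
lemma StrongConvexOn.norm_sub_le_of_isMinOn {E : Type*} [NormedAddCommGroup E]
    [InnerProductSpace ℝ E] {s : Set E} {c l : ℝ} {f : E → ℝ} (hf : StrongConvexOn s c f)
    (hl : 0 ≤ l) (hcl : 0 < c + l) {u v a b : E} (ha : a ∈ s) (hb : b ∈ s)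
    (hau : IsMinOn (fun w => f w + l / 2 * ‖w - u‖ ^ 2) s a)
    (hbv : IsMinOn (fun w => f w + l / 2 * ‖w - v‖ ^ 2) s b) :
    ‖a - b‖ ≤ l / (c + l) * ‖u - v‖ := by
  have h₁ := (hf.add_sq_norm_sub l u).add_le_of_isMinOn ha hb hau
  have h₂ := (hf.add_sq_norm_sub l v).add_le_of_isMinOn hb ha hbv
  rw [norm_sub_rev b a] at h₂
  simp only [norm_sub_sq_real _ u, norm_sub_sq_real _ v] at h₁ h₂
  have hinner : (c + l) * ‖a - b‖ ^ 2 ≤ l * ⟪a - b, u - v⟫ := by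
    simp only [inner_sub_left, inner_sub_right]
    linarith
  have hcs := mul_le_mul_of_nonneg_left (real_inner_le_norm (a - b) (u - v)) hl
  rw [div_mul_eq_mul_div, le_div_iff₀ hcl]
  rcases (norm_nonneg (a - b)).eq_or_lt with h0 | hpos
  · rw [← h0, zero_mul]
    positivity
  · refine le_of_mul_le_mul_left ?_ hpos
    linarith

/-- FedMeS Theorem 2: the personalized minimizer map `W(v) = argmin_w [L(w) + (λ/2)‖w − v‖²]`
is `(λ/(c+λ))`-Lipschitz, so `𝔼‖V − v̄‖² ≤ g` implies `𝔼‖W(V) − W(v̄)‖² ≤ (λ/(c+λ))² g`. -/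
theorem fedmes_theorem2
    {E : Type*} [NormedAddCommGroup E] [InnerProductSpace ℝ E] [FiniteDimensional ℝ E]
    (c lam : ℝ) (hc : 0 < c) (hlam : 0 ≤ lam)
    (L : E → ℝ) (hL : Differentiable ℝ L)
    (hconv : ConvexOn ℝ Set.univ fun x => L x - (c / 2) * ‖x‖ ^ 2)
    (W : E → E)
    (hW : ∀ v w : E, L (W v) + (lam / 2) * ‖W v - v‖ ^ 2 ≤ L w + (lam / 2) * ‖w - v‖ ^ 2)
    {Ω : Type*} [MeasurableSpace Ω] (P : Measure Ω) [IsProbabilityMeasure P]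
    (vbar : E) (g : ℝ) (hg : 0 ≤ g)
    (V : Ω → E) (hVmeas : AEStronglyMeasurable V P)
    (hVint : Integrable (fun ω => ‖V ω - vbar‖ ^ 2) P)
    (hVbound : (∫ ω, ‖V ω - vbar‖ ^ 2 ∂P) ≤ g) :
    Integrable (fun ω => ‖W (V ω) - W vbar‖ ^ 2) P ∧
      (∫ ω, ‖W (V ω) - W vbar‖ ^ 2 ∂P) ≤ (lam / (c + lam)) ^ 2 * g := by
  have hmin : ∀ v, IsMinOn (fun w => L w + lam / 2 * ‖w - v‖ ^ 2) Set.univ (W v) :=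
    fun v w _ => hW v w
  have hdist : ∀ u v, ‖W u - W v‖ ≤ lam / (c + lam) * ‖u - v‖ := fun u v =>
    (strongConvexOn_iff_convex.2 hconv).norm_sub_le_of_isMinOn hlam (by positivity)
      (Set.mem_univ _) (Set.mem_univ _) (hmin u) (hmin v)
  have hcont : Continuous W :=
    (LipschitzWith.of_dist_le' fun u v => by simpa only [dist_eq_norm] using hdist u v).continuous
  have hsq : ∀ ω, ‖W (V ω) - W vbar‖ ^ 2 ≤ (lam / (c + lam)) ^ 2 * ‖V ω - vbar‖ ^ 2 := fun ω => by
    rw [← mul_pow]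
    exact pow_le_pow_left₀ (norm_nonneg _) (hdist _ _) 2
  have hbound := hVint.const_mul ((lam / (c + lam)) ^ 2)
  have hint : Integrable (fun ω => ‖W (V ω) - W vbar‖ ^ 2) P :=
    hbound.mono' (((hcont.comp_aestronglyMeasurable hVmeas).sub
      aestronglyMeasurable_const).norm.pow 2) (.of_forall fun ω => by
        rw [Real.norm_of_nonneg (by positivity)]
        exact hsq ω)
  refine ⟨hint, (integral_mono hint hbound hsq).trans ?_⟩
  rw [integral_const_mul]
  gcongr
end
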